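/- Consider the 6R linkage with Denavit–Hartenberg data given by Bennett ratios (b₁, …, b₆) = (−1/3, −61/33, 305/429, 2000/1001, −2900/1001, 1740/1001), parameters (w₁, …, w₆) = (2/3, −4, 6/5, 1/2, √54083849/6619, 3/7), and offsets (s₁, …, s₆) = (2/3, 0, 0, 2/3, 0, 0), with dᵢ = bᵢ·2wᵢ/(1 + wᵢ²) and gᵢ = (1 − (sᵢ/2)·ε𝐢)·(wᵢ·1 − 𝐤)·(1 − (dᵢ/2)·ε𝐤). Then the configuration set {(t₁, …, t₆) ∈ ℝ⁶ : there exists r ∈ ℝ, r ≠ 0, with (t₁·1 − 𝐢)·g₁·(t₂·1 − 𝐢)·g₂·(t₃·1 − 𝐢)·g₃·(t₄·1 − 𝐢)·g₄·(t₅·1 − 𝐢)·g₅·(t₆·1 − 𝐢)·g₆ = r·1} is infinite; that is, this linkage is mobile. -/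

import Mathlib

open Quaternion TrivSqZeroExt DualNumber

noncomputable section

/-- The real dual quaternions. -/
abbrev DQR : Type := DualNumber (Quaternion ℝ)

/-- The quaternion unit 𝐢, viewed as a dual quaternion. -/
def qi : DQR := inl (⟨0,1,0,0⟩ : ℍ[ℝ])
/-- The quaternion unit 𝐤, viewed as a dual quaternion. -/
def qk : DQR := inl (⟨0,0,0,1⟩ : ℍ[ℝ])

/-- A real scalar, viewed as a dual quaternion. -/
def rs (r : ℝ) : DQR := inl (algebraMap ℝ ℍ[ℝ] r)

/-- Bennett ratios of the new linkage. -/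
def bL : Fin 6 → ℝ := ![-1/3, -61/33, 305/429, 2000/1001, -2900/1001, 1740/1001]

/-- The parameters `wᵢ = cot(φᵢ/2)` of the new linkage. -/
def wL : Fin 6 → ℝ := ![2/3, -4, 6/5, 1/2, Real.sqrt 54083849 / 6619, 3/7]

/-- Offsets of the new linkage. -/
def sL : Fin 6 → ℝ := ![2/3, 0, 0, 2/3, 0, 0]

/-- Normal distances `dᵢ = bᵢ · 2wᵢ/(1 + wᵢ²)` of the new linkage. -/
def dL (i : Fin 6) : ℝ := bL i * 2 * wL i / (1 + (wL i)^2)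

/-- Joint dual quaternion `gᵢ = (1 − (sᵢ/2)ε𝐢)(wᵢ − 𝐤)(1 − (dᵢ/2)ε𝐤)` of the new linkage. -/
def gL (i : Fin 6) : DQR :=
  (1 - rs (sL i / 2) * ε * qi) * (rs (wL i) - qk) * (1 - rs (dL i / 2) * ε * qk)

/-- The dual quaternion with primal part `a₀ + a₁𝐢 + a₂𝐣 + a₃𝐤` and dual part
`b₀ + b₁𝐢 + b₂𝐣 + b₃𝐤`. -/
def dq (a₀ a₁ a₂ a₃ b₀ b₁ b₂ b₃ : ℝ) : DQR :=
  ((⟨a₀, a₁, a₂, a₃⟩ : ℍ[ℝ]), (⟨b₀, b₁, b₂, b₃⟩ : ℍ[ℝ]))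

section Components

variable (a₀ a₁ a₂ a₃ b₀ b₁ b₂ b₃ : ℝ)

@[simp] lemma fst_re_dq : (dq a₀ a₁ a₂ a₃ b₀ b₁ b₂ b₃).fst.re = a₀ := rfl
@[simp] lemma fst_imI_dq : (dq a₀ a₁ a₂ a₃ b₀ b₁ b₂ b₃).fst.imI = a₁ := rfl
@[simp] lemma fst_imJ_dq : (dq a₀ a₁ a₂ a₃ b₀ b₁ b₂ b₃).fst.imJ = a₂ := rfl
@[simp] lemma fst_imK_dq : (dq a₀ a₁ a₂ a₃ b₀ b₁ b₂ b₃).fst.imK = a₃ := rfl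
@[simp] lemma snd_re_dq : (dq a₀ a₁ a₂ a₃ b₀ b₁ b₂ b₃).snd.re = b₀ := rfl
@[simp] lemma snd_imI_dq : (dq a₀ a₁ a₂ a₃ b₀ b₁ b₂ b₃).snd.imI = b₁ := rfl
@[simp] lemma snd_imJ_dq : (dq a₀ a₁ a₂ a₃ b₀ b₁ b₂ b₃).snd.imJ = b₂ := rfl
@[simp] lemma snd_imK_dq : (dq a₀ a₁ a₂ a₃ b₀ b₁ b₂ b₃).snd.imK = b₃ := rfl

end Components

lemma dq_ext {p q : DQR} (h₀ : p.fst.re = q.fst.re) (h₁ : p.fst.imI = q.fst.imI)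
    (h₂ : p.fst.imJ = q.fst.imJ) (h₃ : p.fst.imK = q.fst.imK) (k₀ : p.snd.re = q.snd.re)
    (k₁ : p.snd.imI = q.snd.imI) (k₂ : p.snd.imJ = q.snd.imJ) (k₃ : p.snd.imK = q.snd.imK) :
    p = q :=
  TrivSqZeroExt.ext (Quaternion.ext _ _ h₀ h₁ h₂ h₃) (Quaternion.ext _ _ k₀ k₁ k₂ k₃)

lemma dq_mul (a₀ a₁ a₂ a₃ b₀ b₁ b₂ b₃ c₀ c₁ c₂ c₃ d₀ d₁ d₂ d₃ : ℝ) :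
    dq a₀ a₁ a₂ a₃ b₀ b₁ b₂ b₃ * dq c₀ c₁ c₂ c₃ d₀ d₁ d₂ d₃ =
      dq (a₀ * c₀ - a₁ * c₁ - a₂ * c₂ - a₃ * c₃) (a₀ * c₁ + a₁ * c₀ + a₂ * c₃ - a₃ * c₂)
        (a₀ * c₂ - a₁ * c₃ + a₂ * c₀ + a₃ * c₁) (a₀ * c₃ + a₁ * c₂ - a₂ * c₁ + a₃ * c₀)
        (a₀ * d₀ - a₁ * d₁ - a₂ * d₂ - a₃ * d₃ + (b₀ * c₀ - b₁ * c₁ - b₂ * c₂ - b₃ * c₃))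
        (a₀ * d₁ + a₁ * d₀ + a₂ * d₃ - a₃ * d₂ + (b₀ * c₁ + b₁ * c₀ + b₂ * c₃ - b₃ * c₂))
        (a₀ * d₂ - a₁ * d₃ + a₂ * d₀ + a₃ * d₁ + (b₀ * c₂ - b₁ * c₃ + b₂ * c₀ + b₃ * c₁))
        (a₀ * d₃ + a₁ * d₂ - a₂ * d₁ + a₃ * d₀ + (b₀ * c₃ + b₁ * c₂ - b₂ * c₁ + b₃ * c₀)) := by
  apply dq_ext <;> simp

lemma smul_dq (r a₀ a₁ a₂ a₃ b₀ b₁ b₂ b₃ : ℝ) :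
    r • dq a₀ a₁ a₂ a₃ b₀ b₁ b₂ b₃ =
      dq (r * a₀) (r * a₁) (r * a₂) (r * a₃) (r * b₀) (r * b₁) (r * b₂) (r * b₃) := by
  apply dq_ext <;> simp

lemma rs_eq_dq (r : ℝ) : rs r = dq r 0 0 0 0 0 0 0 := by
  apply dq_ext <;> simp [rs]

lemma rs_eq_smul_one (r : ℝ) : rs r = r • (1 : DQR) := by
  apply dq_ext <;> simp [rs]

lemma qi_eq_dq : qi = dq 0 1 0 0 0 0 0 0 := rfl

lemma qk_eq_dq : qk = dq 0 0 0 1 0 0 0 0 := rfl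

lemma rs_sub_qi (t : ℝ) : rs t - qi = dq t (-1) 0 0 0 0 0 0 := by
  apply dq_ext <;> simp [rs, qi_eq_dq]

/-- The joint dual quaternion with offset `s`, parameter `w` and normal distance `d`. -/
def joint (s w d : ℝ) : DQR := dq w 0 0 (-1) (-d / 2) (-s * w / 2) (-s / 2) (-d * w / 2)

/-- The conjugate of the joint dual quaternion. -/
def jointConj (s w d : ℝ) : DQR := dq w 0 0 1 (-d / 2) (s * w / 2) (s / 2) (d * w / 2)

lemma gL_eq_joint (i : Fin 6) : gL i = joint (sL i) (wL i) (dL i) := by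
  have h₁ (r : ℝ) : 1 - rs r * ε * qi = dq 1 0 0 0 0 (-r) 0 0 := by
    apply dq_ext <;> simp [rs, qi_eq_dq]
  have h₂ (r : ℝ) : 1 - rs r * ε * qk = dq 1 0 0 0 0 0 0 (-r) := by
    apply dq_ext <;> simp [rs, qk_eq_dq]
  have h₃ (r : ℝ) : rs r - qk = dq r 0 0 (-1) 0 0 0 0 := by
    apply dq_ext <;> simp [rs, qk_eq_dq]
  rw [gL, h₁, h₂, h₃, dq_mul, dq_mul, joint]
  congr 1 <;> ring

lemma joint_mul_jointConj (s w d : ℝ) : joint s w d * jointConj s w d = (w ^ 2 + 1) • (1 : DQR) := by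
  rw [← rs_eq_smul_one, rs_eq_dq, joint, jointConj, dq_mul]
  congr 1 <;> ring

lemma jointConj_mul_joint (s w d : ℝ) : jointConj s w d * joint s w d = (w ^ 2 + 1) • (1 : DQR) := by
  rw [← rs_eq_smul_one, rs_eq_dq, joint, jointConj, dq_mul]
  congr 1 <;> ring

/-- The dual quaternion `(A + B𝐢)(1 - βε) + (C𝐣 + D𝐤)(1 + βw²ε)`. -/
def chain (β w A B C D : ℝ) : DQR :=
  dq A B C D (-β * A) (-β * B) (β * w ^ 2 * C) (β * w ^ 2 * D)

/-- The conjugate of `chain β w A B C D`. -/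
def chainConj (β w A B C D : ℝ) : DQR :=
  dq A (-B) (-C) (-D) (-β * A) (β * B) (-β * w ^ 2 * C) (-β * w ^ 2 * D)

lemma chainConj_mul_chain {β w A B C D : ℝ} (h : A ^ 2 + B ^ 2 = w ^ 2 * (C ^ 2 + D ^ 2)) :
    chainConj β w A B C D * chain β w A B C D = ((w ^ 2 + 1) * (C ^ 2 + D ^ 2)) • (1 : DQR) := by
  rw [← rs_eq_smul_one, rs_eq_dq, chain, chainConj, dq_mul]
  congr 1
  · linear_combination h
  · ring
  · ring
  · ring
  · linear_combination -2 * β * h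
  · ring
  · ring
  · ring

/-- Points of the quadric `A² + B² = w²(C² + D²)` off a hyperplane come from two-joint chains. -/
lemma exists_chain_eq {β w A B C D : ℝ} (hw : w ≠ 0) (h : A ^ 2 + B ^ 2 = w ^ 2 * (C ^ 2 + D ^ 2))
    (hne : A + w * D ≠ 0) :
    ∃ t s σ : ℝ, σ ≠ 0 ∧ (rs t - qi) * joint 0 w (2 * β * w) * (rs s - qi) =
      σ • chain β w A B C D := by
  refine ⟨(B - w * C) / (A + w * D), (B + w * C) / (A + w * D), -2 * w / (A + w * D), ?_, ?_⟩
  · exact div_ne_zero (mul_ne_zero (by norm_num) hw) hne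
  · rw [rs_sub_qi, rs_sub_qi, joint, chain, dq_mul, dq_mul, smul_dq]
    have h₁ : (B - w * C) * (B + w * C) = (w * D - A) * (w * D + A) := by linear_combination h
    have h₂ : (B - w * C) / (A + w * D) * ((B + w * C) / (A + w * D)) =
        (w * D - A) / (A + w * D) := by
      field_simp
      linear_combination h₁
    generalize ht : (B - w * C) / (A + w * D) = t at *
    generalize hs : (B + w * C) / (A + w * D) = s at *
    have hA : w * (t * s - 1) = -2 * w / (A + w * D) * A := by
      rw [h₂]; field_simp; ring
    have hB : -w * (t + s) = -2 * w / (A + w * D) * B := by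
      rw [← ht, ← hs]; field_simp; ring
    have hC : t - s = -2 * w / (A + w * D) * C := by
      rw [← ht, ← hs]; field_simp; ring
    have hD : -(t * s + 1) = -2 * w / (A + w * D) * D := by
      rw [h₂]; field_simp; ring
    congr 1
    · linear_combination hA
    · linear_combination hB
    · linear_combination hC
    · linear_combination hD
    · linear_combination -β * hA
    · linear_combination -β * hB
    · linear_combination β * w ^ 2 * hC
    · linear_combination β * w ^ 2 * hD

/-! Coordinates of the kernel vectors of the closure equation, linear in `m`, at `t₁ = t₄ = x`. -/

def pA (x m : ℝ) : ℝ :=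
  m * (150542977384800 - 1377134538942240 * x - 93806618986080 * x ^ 2)
    + (1238241748089760 + 561136041385920 * x + 2274971275254400 * x ^ 2)

def pB (x m : ℝ) : ℝ :=
  m * (-1331943555630800 - 57904550383680 * x - 1727962923096560 * x ^ 2)
    + (-289614841195680 - 3228541039899360 * x + 488192095591200 * x ^ 2)

def pC (x m : ℝ) : ℝ :=
  m * (1533997540333740 - 436899232049280 * x + 1063976930299500 * x ^ 2)
    + (-1317525289080000 - 12249476997339840 * x + 1376362994086080 * x ^ 2)

def pD (x m : ℝ) : ℝ :=
  m * (-161347074208320 + 368617292322240 * x - 368192270846400 * x ^ 2)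
    + (2626770518781900 - 1459588765514880 * x - 3875237891021940 * x ^ 2)

def qA (x m : ℝ) : ℝ :=
  m * (-287337722103432 + 3250464023787120 * x + 442316563160472 * x ^ 2)
    + (598860106999287 - 589015797866496 * x + 1647948697292247 * x ^ 2)

def qB (x m : ℝ) : ℝ :=
  m * (-1266717517274181 - 678520694019168 * x + 1687472654142219 * x ^ 2)
    + (-776666861314344 - 1304943294180960 * x - 1238058072427176 * x ^ 2)

def qC (x m : ℝ) : ℝ :=
  m * (-2399566668022797 + 578360719800864 * x - 2120920768252797 * x ^ 2)
    + (1625735031632712 + 14563319204609280 * x - 1507221800236152 * x ^ 2)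

def qD (x m : ℝ) : ℝ :=
  m * (65614493160216 - 1091344827126960 * x - 248771305318536 * x ^ 2)
    + (-3832123799740551 - 136036924575552 * x - 5771153085314631 * x ^ 2)

/-- The closure equation is solved linearly by the kernel vectors. -/
lemma chain_mul_joint_eq (x m : ℝ) {w : ℝ} (hw : w ^ 2 = 8171 / 6619) :
    chain (-61 / 561) (-4) (pA x m) (pB x m) (pC x m) (pD x m) *
        (joint 0 (6 / 5) (dL 2) * (rs x - qi) * joint (2 / 3) (1 / 2) (dL 3)) =
      jointConj (2 / 3) (2 / 3) (dL 0) * dq x 1 0 0 0 0 0 0 * jointConj 0 (3 / 7) (dL 5) *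
        chainConj (-66190 / 51051) w (qA x m) (qB x m) (qC x m) (qD x m) := by
  have h₀ : dL 0 = -1 / 3 * 2 * (2 / 3) / (1 + (2 / 3) ^ 2) := rfl
  have h₂ : dL 2 = 305 / 429 * 2 * (6 / 5) / (1 + (6 / 5) ^ 2) := rfl
  have h₃ : dL 3 = 2000 / 1001 * 2 * (1 / 2) / (1 + (1 / 2) ^ 2) := rfl
  have h₅ : dL 5 = 1740 / 1001 * 2 * (3 / 7) / (1 + (3 / 7) ^ 2) := rfl
  rw [h₀, h₂, h₃, h₅, rs_sub_qi]
  simp only [chain, chainConj, joint, jointConj, hw, dq_mul]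
  simp only [pA, pB, pC, pD, qA, qB, qC, qD]
  congr 1 <;> ring

lemma quadric_q_eq (x m : ℝ) :
    qA x m ^ 2 + qB x m ^ 2 - 8171 / 6619 * (qC x m ^ 2 + qD x m ^ 2) =
      11486727 / 76780400 *
        (pA x m ^ 2 + pB x m ^ 2 - (-4) ^ 2 * (pC x m ^ 2 + pD x m ^ 2)) := by
  simp only [pA, pB, pC, pD, qA, qB, qC, qD]
  ring

lemma exists_mem_quadric {x : ℝ} (hx : x ∈ Set.Ioo (-3 / 2 : ℝ) (-1499 / 1000)) :
    ∃ m ∈ Set.Icc (-61 / 10 : ℝ) (-6),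
      pA x m ^ 2 + pB x m ^ 2 = (-4) ^ 2 * (pC x m ^ 2 + pD x m ^ 2) := by
  obtain ⟨y, rfl⟩ : ∃ y, x = -3 / 2 + y := ⟨x + 3 / 2, by ring⟩
  obtain ⟨h₁, h₂⟩ := hx
  have h0 : 0 ≤ y := by linarith
  have h1 : y ≤ 1 / 1000 := by linarith
  have k0 : 0 ≤ y ^ 2 := by positivity
  have k1 : y ^ 2 ≤ 1 / 1000 * y := by nlinarith
  have l0 : 0 ≤ y ^ 3 := by positivity
  have l1 : y ^ 3 ≤ 1 / 1000 * y ^ 2 := by nlinarith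
  have n0 : 0 ≤ y ^ 4 := by positivity
  have n1 : y ^ 4 ≤ 1 / 1000 * y ^ 3 := by nlinarith
  have hc : ContinuousOn (fun m => pA (-3 / 2 + y) m ^ 2 + pB (-3 / 2 + y) m ^ 2 -
      (-4) ^ 2 * (pC (-3 / 2 + y) m ^ 2 + pD (-3 / 2 + y) m ^ 2))
      (Set.Icc (-61 / 10 : ℝ) (-6)) := by
    simp only [pA, pB, pC, pD]
    fun_prop
  obtain ⟨m, hm, h⟩ := intermediate_value_Icc (by norm_num) hc (show (0 : ℝ) ∈ _ from by
    constructor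
    · simp only [pA, pB, pC, pD]
      ring_nf
      linarith
    · simp only [pA, pB, pC, pD]
      ring_nf
      linarith)
  exact ⟨m, hm, by linear_combination h⟩

lemma hyperplane_ne_zero {x m w : ℝ} (hx : x ∈ Set.Ioo (-3 / 2 : ℝ) (-1499 / 1000))
    (hm : m ∈ Set.Icc (-61 / 10 : ℝ) (-6)) (hw0 : 0 < w) (hw : w ^ 2 = 8171 / 6619) :
    pA x m + -4 * pD x m ≠ 0 ∧ qA x m + w * qD x m ≠ 0 := by
  obtain ⟨y, rfl⟩ : ∃ y, x = -3 / 2 + y := ⟨x + 3 / 2, by ring⟩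
  obtain ⟨n, rfl⟩ : ∃ n, m = -6 - n := ⟨-6 - m, by ring⟩
  obtain ⟨h₁, h₂⟩ := hx
  obtain ⟨h₃, h₄⟩ := hm
  have h0 : 0 ≤ y := by linarith
  have h1 : y ≤ 1 / 1000 := by linarith
  have k0 : 0 ≤ y ^ 2 := by positivity
  have k1 : y ^ 2 ≤ 1 / 1000 * y := by nlinarith
  have n0 : 0 ≤ n := by linarith
  have n1 : n ≤ 1 / 10 := by linarith
  have a0 : 0 ≤ n * y := by positivity
  have a1 : n * y ≤ 1 / 10 * y := by nlinarith
  have b0 : 0 ≤ n * y ^ 2 := by positivity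
  have b1 : n * y ^ 2 ≤ 1 / 10 * y ^ 2 := by nlinarith
  constructor
  · apply ne_of_lt
    simp only [pA, pD]
    ring_nf
    linarith
  · apply ne_of_gt
    have hw1 : w ≤ 11111 / 10000 := by nlinarith
    have hD : qD (-3 / 2 + y) (-6 - n) ≤ 0 := by
      simp only [qD]
      ring_nf
      linarith
    have hA : 0 < qA (-3 / 2 + y) (-6 - n) + 11111 / 10000 * qD (-3 / 2 + y) (-6 - n) := by
      simp only [qA, qD]
      ring_nf
      linarith
    nlinarith

/-- Two chains `X`, `Y` and the other joints close up. -/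
lemma closure_of_chain {A : Type*} [Ring A] [Algebra ℝ A] {X Y U Yc a a' e e' T T' P R : A}
    {nT na ne nY τ σ : ℝ} (hX : P = τ • X) (hY : R = σ • Y) (h : X * U = a' * T' * e' * Yc)
    (hYc : Yc * Y = nY • (1 : A)) (hT : T * T' = nT • (1 : A)) (ha : a * a' = na • (1 : A))
    (he : e' * e = ne • (1 : A)) :
    T * a * (P * U * R) * e = (τ * σ * nY * nT * na * ne) • (1 : A) := by
  calc T * a * (P * U * R) * e
      = (σ * τ) • (T * a * (X * U) * Y * e) := by
        simp only [hX, hY, smul_mul_assoc, mul_smul_comm, smul_smul, mul_assoc]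
    _ = (σ * τ) • (T * (a * a') * T' * e' * (Yc * Y) * e) := by
        rw [h]
        simp only [mul_assoc]
    _ = (σ * τ * nY * na) • (T * T' * (e' * e)) := by
        rw [hYc, ha]
        simp only [smul_mul_assoc, mul_smul_comm, smul_smul, mul_one, mul_assoc]
    _ = (τ * σ * nY * nT * na * ne) • (1 : A) := by
        rw [hT, he]
        simp only [smul_mul_assoc, smul_smul, one_mul]
        congr 1
        ring

lemma wL_four_sq : wL 4 ^ 2 = 8171 / 6619 := by
  simp [wL, div_pow]
  norm_num

lemma wL_four_pos : 0 < wL 4 := by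
  simp [wL]

/-- A configuration exists for every value of `t₁` in an interval. -/
lemma exists_configuration {x : ℝ} (hx : x ∈ Set.Ioo (-3 / 2 : ℝ) (-1499 / 1000)) :
    ∃ t₂ t₃ t₅ t₆ r : ℝ, r ≠ 0 ∧
      (rs x - qi) * gL 0 * (rs t₂ - qi) * gL 1 * (rs t₃ - qi) * gL 2 *
        (rs x - qi) * gL 3 * (rs t₅ - qi) * gL 4 * (rs t₆ - qi) * gL 5 = rs r := by
  obtain ⟨m, hm, hp⟩ := exists_mem_quadric hx
  obtain ⟨hne, hne'⟩ := hyperplane_ne_zero hx hm wL_four_pos wL_four_sq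
  have hq : qA x m ^ 2 + qB x m ^ 2 = wL 4 ^ 2 * (qC x m ^ 2 + qD x m ^ 2) := by
    rw [wL_four_sq]
    linear_combination quadric_q_eq x m + 11486727 / 76780400 * hp
  obtain ⟨t₂, t₃, τ, hτ, hX⟩ := exists_chain_eq (β := -61 / 561) (by norm_num) hp hne
  obtain ⟨t₅, t₆, σ, hσ, hY⟩ :=
    exists_chain_eq (β := -66190 / 51051) wL_four_pos.ne' hq hne'
  have hT : (rs x - qi) * dq x 1 0 0 0 0 0 0 = (x ^ 2 + 1) • (1 : DQR) := by
    rw [rs_sub_qi, ← rs_eq_smul_one, rs_eq_dq, dq_mul]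
    congr 1 <;> ring
  have key := closure_of_chain hX hY (chain_mul_joint_eq x m wL_four_sq) (chainConj_mul_chain hq)
    hT (joint_mul_jointConj _ _ _) (jointConj_mul_joint _ _ _)
  have e₀ : gL 0 = joint (2 / 3) (2 / 3) (dL 0) := gL_eq_joint 0
  have e₁ : gL 1 = joint 0 (-4) (2 * (-61 / 561) * -4) := by
    have : dL 1 = 2 * (-61 / 561) * -4 := by norm_num [dL, bL, wL]
    rw [← this]
    exact gL_eq_joint 1
  have e₂ : gL 2 = joint 0 (6 / 5) (dL 2) := gL_eq_joint 2
  have e₃ : gL 3 = joint (2 / 3) (1 / 2) (dL 3) := gL_eq_joint 3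
  have e₄ : gL 4 = joint 0 (wL 4) (2 * (-66190 / 51051) * wL 4) := by
    have : dL 4 = 2 * (-66190 / 51051) * wL 4 := by
      have hb : bL 4 = -2900 / 1001 := rfl
      rw [dL, wL_four_sq, hb]
      ring
    rw [← this]
    exact gL_eq_joint 4
  have e₅ : gL 5 = joint 0 (3 / 7) (dL 5) := gL_eq_joint 5
  refine ⟨t₂, t₃, t₅, t₆, _, ?_, Eq.trans ?_ (key.trans (rs_eq_smul_one _).symm)⟩
  · have hD : 0 < qC x m ^ 2 + qD x m ^ 2 := by
      by_contra! h
      have hC0 : qD x m = 0 := by nlinarith [sq_nonneg (qC x m), sq_nonneg (qD x m)]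
      have hA0 : qA x m = 0 := by
        have : qA x m ^ 2 ≤ 0 := by nlinarith [sq_nonneg (qB x m), sq_nonneg (wL 4)]
        nlinarith [sq_nonneg (qA x m)]
      exact hne' (by rw [hA0, hC0]; ring)
    positivity
  · rw [e₀, e₁, e₂, e₃, e₄, e₅]
    simp only [mul_assoc]

/-- The configuration set of the new 6R linkage is infinite: the linkage is mobile. -/
theorem new_linkage_is_mobile :
    {t : Fin 6 → ℝ | ∃ r : ℝ, r ≠ 0 ∧
      (rs (t 0) - qi) * gL 0 * (rs (t 1) - qi) * gL 1 * (rs (t 2) - qi) * gL 2 *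
        (rs (t 3) - qi) * gL 3 * (rs (t 4) - qi) * gL 4 * (rs (t 5) - qi) * gL 5 =
        rs r}.Infinite := by
  refine Set.Infinite.of_image (fun t => t 0) ?_
  refine (Set.Ioo_infinite (show (-3 / 2 : ℝ) < -1499 / 1000 by norm_num)).mono fun x hx => ?_
  obtain ⟨t₂, t₃, t₅, t₆, r, hr, h⟩ := exists_configuration hx
  exact ⟨![x, t₂, t₃, x, t₅, t₆], ⟨r, hr, h⟩, rfl⟩
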